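/- Let B be a positive diagonal N×N matrix, G : R^N → R^N continuous and energy-preserving. Then for every F ∈ R^N the equation G(x) − Bx + F = 0 has at least one solution x ∈ R^N. -/

import Mathlib

open Polynomial in
theorem aux_det_interp {E : Type*} [NormedAddCommGroup E] [NormedSpace ℝ E] [FiniteDimensional ℝ E]
    (A : E →L[ℝ] E) (v : ℕ → ℝ) (hv : Function.Injective v) :
    (ContinuousLinearMap.id ℝ E + A).det =
      ∑ j ∈ Finset.range (Module.finrank ℝ E + 1),
        (Lagrange.basis (Finset.range (Module.finrank ℝ E + 1)) v j).eval 1 *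
          (ContinuousLinearMap.id ℝ E + v j • A).det := by
  let b := Module.finBasis ℝ E
  let M := LinearMap.toMatrix b b (A : E →ₗ[ℝ] E)
  let p : ℝ[X] := Matrix.det ((X : ℝ[X]) • M.map C + (1 : Matrix _ _ ℝ).map C)
  have hp : ∀ t : ℝ, p.eval t = (ContinuousLinearMap.id ℝ E + t • A).det := by
    intro t
    have h1 : (ContinuousLinearMap.id ℝ E + t • A).det = (t • M + 1).det := by
      change LinearMap.det _ = _
      rw [← LinearMap.det_toMatrix b]
      congr 1
      simp [M, add_comm]
    rw [h1, ← Polynomial.coe_evalRingHom, RingHom.map_det]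
    congr 1
    ext i k
    by_cases h : i = k <;> simp [h] <;> ring
  have hdeg : p.degree < (Finset.range (Module.finrank ℝ E + 1)).card := by
    have := Polynomial.natDegree_det_X_add_C_le M (1 : Matrix _ _ ℝ)
    simp only [Fintype.card_fin] at this
    rw [Finset.card_range]
    refine lt_of_le_of_lt Polynomial.degree_le_natDegree ?_
    exact_mod_cast Nat.lt_succ_of_le this
  have h := Lagrange.eq_interpolate (hv.injOn) hdeg
  have h2 := hp 1
  rw [one_smul] at h2
  rw [← h2]
  conv_lhs => rw [h]
  rw [Lagrange.interpolate_apply, Polynomial.eval_finsetSum]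
  refine Finset.sum_congr rfl fun j _ => ?_
  rw [Polynomial.eval_mul, Polynomial.eval_C, hp, mul_comm]

open MeasureTheory in
theorem aux_no_retr {E : Type*} [NormedAddCommGroup E] [InnerProductSpace ℝ E]
    [FiniteDimensional ℝ E] [MeasurableSpace E] [BorelSpace E] (R : ℝ) (hR : 0 < R)
    (g : E → E) (K : NNReal) (hg : LipschitzWith K g) (hout : ∀ x, R ≤ ‖x‖ → g x = 0)
    (hd : ∀ x, ‖x‖ < R → DifferentiableAt ℝ g x) (hs : ∀ x, ‖x‖ < R → ‖x + g x‖ = R) : False := by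
  set U : Set E := Metric.ball 0 R with hU
  have memU : ∀ x, x ∈ U ↔ ‖x‖ < R := fun x => by simp [hU]
  let D : ℝ → E → E →L[ℝ] E := fun t x => ContinuousLinearMap.id ℝ E + t • fderiv ℝ g x
  have hder : ∀ t x, x ∈ U → HasFDerivAt (fun y => y + t • g y) (D t x) x := fun t x hx =>
    (hasFDerivAt_id x).add ((hd x ((memU x).1 hx)).hasFDerivAt.const_smul t)
  -- determinant vanishes at time one
  have hzero : ∀ x ∈ U, (ContinuousLinearMap.id ℝ E + fderiv ℝ g x).det = 0 := by
    intro x hx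
    by_contra hne
    have h1 : HasFDerivAt (fun y => y + g y) (ContinuousLinearMap.id ℝ E + fderiv ℝ g x) x := by
      simpa [D] using hder 1 x hx
    have h2 := h1.norm_sq
    have h3 : (fun y => ‖y + g y‖ ^ 2) =ᶠ[nhds x] fun _ => R ^ 2 := by
      filter_upwards [Metric.isOpen_ball.mem_nhds hx] with y hy
      rw [hs y ((memU y).1 hy)]
    have h4 := h2.unique ((hasFDerivAt_const (R ^ 2) x).congr_of_eventuallyEq h3)
    obtain ⟨w, hw⟩ : ∃ w, (ContinuousLinearMap.id ℝ E + fderiv ℝ g x) w = x + g x := by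
      have hu : IsUnit (LinearMap.det
        ((ContinuousLinearMap.id ℝ E + fderiv ℝ g x : E →L[ℝ] E) : E →ₗ[ℝ] E)) :=
        isUnit_iff_ne_zero.2 hne
      obtain ⟨w, hw⟩ := (LinearMap.equivOfIsUnitDet hu).surjective (x + g x)
      exact ⟨w, by simpa using hw⟩
    have h5 := DFunLike.congr_fun h4 w
    have h6 := hs x ((memU x).1 hx)
    simp only [smul_apply, ContinuousLinearMap.comp_apply, hw, innerSL_apply_apply,
      real_inner_self_eq_norm_sq, h6, zero_apply] at h5
    have : 0 < R ^ 2 := by positivity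
    simp at h5
    linarith
  -- small times
  obtain ⟨δ, hδ, hdet⟩ : ∃ δ > 0, ∀ A : E →L[ℝ] E, ‖A‖ < δ →
      0 < (ContinuousLinearMap.id ℝ E + A).det := by
    have hc : Continuous fun A : E →L[ℝ] E => (ContinuousLinearMap.id ℝ E + A).det :=
      ContinuousLinearMap.continuous_det.comp (continuous_const.add continuous_id)
    have h0 : (0 : ℝ) < (ContinuousLinearMap.id ℝ E + (0 : E →L[ℝ] E)).det := by
      simp [ContinuousLinearMap.det]
    obtain ⟨δ, hδ, h⟩ := Metric.eventually_nhds_iff.1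
      (hc.continuousAt.eventually (lt_mem_nhds h0))
    exact ⟨δ, hδ, fun A hA => h (by simpa using hA)⟩
  set ε := min δ 1 / (K + 1) with hε
  have hK : (0 : ℝ) ≤ K := K.2
  have hεpos : 0 < ε := by positivity
  have hεK : ∀ t, 0 < t → t < ε → t * K < min δ 1 := by
    intro t ht hte
    rw [hε, lt_div_iff₀ (by positivity)] at hte
    nlinarith
  have key : ∀ t, 0 < t → t < ε →
      IntegrableOn (fun x => (D t x).det) U volume ∧
      ∫ x in U, (D t x).det = ∫ x in U, (1 : ℝ) := by
    intro t ht hte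
    have htK := hεK t ht hte
    have ht1 : t * K < 1 := htK.trans_le (min_le_right _ _)
    have htδ : t * K < δ := htK.trans_le (min_le_left _ _)
    have hinj : Function.Injective (fun y => y + t • g y) := by
      intro x y hxy
      have h1 : x - y = t • (g y - g x) := by
        rw [smul_sub, sub_eq_sub_iff_add_eq_add]
        simpa [add_comm] using hxy
      have h2 : ‖x - y‖ ≤ t * K * ‖x - y‖ := by
        have := hg.norm_sub_le y x
        calc ‖x - y‖ = t * ‖g y - g x‖ := by
              rw [h1, norm_smul, Real.norm_of_nonneg ht.le]
          _ ≤ t * (K * ‖y - x‖) := by gcongr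
          _ = _ := by rw [norm_sub_rev y x]; ring
      have h3 : ‖x - y‖ = 0 := by nlinarith [norm_nonneg (x - y)]
      exact sub_eq_zero.1 (norm_eq_zero.1 h3)
    have hsurj : Function.Surjective (fun y => y + t • g y) := by
      intro y
      have hc : ContractingWith (Real.toNNReal t * K) (fun x => y - t • g x) := by
        refine ⟨by rw [← NNReal.coe_lt_coe]; simpa [ht.le] using ht1, LipschitzWith.of_dist_le_mul fun a b => ?_⟩
        have := hg.dist_le_mul a b
        rw [dist_sub_left, dist_smul₀, Real.norm_of_nonneg ht.le]
        rw [NNReal.coe_mul, Real.coe_toNNReal t ht.le]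
        calc t * dist (g a) (g b) ≤ t * (K * dist a b) := by gcongr
          _ = _ := by rw [mul_assoc]
      refine ⟨hc.fixedPoint, ?_⟩
      have h := hc.fixedPoint_isFixedPt
      have h' : y - t • g hc.fixedPoint = hc.fixedPoint := h
      exact (eq_add_of_sub_eq h').symm
    have himg : (fun y => y + t • g y) '' U = U := by
      have hid : ∀ x, x ∉ U → x + t • g x = x := by
        intro x hx
        rw [memU, not_lt] at hx
        simp [hout x hx]
      ext y
      constructor
      · rintro ⟨x, hx, rfl⟩
        by_contra hn
        have := hinj (a₁ := x + t • g x) (a₂ := x) (hid _ hn)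
        simp only [this] at hn
        exact hn hx
      · intro hy
        obtain ⟨x, hx⟩ := hsurj y
        refine ⟨x, ?_, hx⟩
        by_contra hn
        have h1 : x + t • g x = y := hx
        rw [hid x hn] at h1
        exact hn (h1 ▸ hy)
    have hpos : ∀ x ∈ U, |(D t x).det| • (1 : ℝ) = (D t x).det := by
      intro x hx
      rw [smul_eq_mul, mul_one, abs_of_pos]
      apply hdet
      rw [norm_smul, Real.norm_of_nonneg ht.le]
      have := norm_fderiv_le_of_lipschitz ℝ hg (x₀ := x)
      refine lt_of_le_of_lt ?_ htδ
      gcongr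
    have hUm : MeasurableSet U := Metric.isOpen_ball.measurableSet
    have hder' : ∀ x ∈ U, HasFDerivWithinAt (fun y => y + t • g y) (D t x) U x :=
      fun x hx => (hder t x hx).hasFDerivWithinAt
    constructor
    · have h := (integrableOn_image_iff_integrableOn_abs_det_fderiv_smul volume hUm hder'
        hinj.injOn (fun _ => (1 : ℝ))).1 (by
          rw [himg]
          exact integrableOn_const (measure_ball_lt_top).ne)
      exact h.congr_fun hpos hUm
    · have h := integral_image_eq_integral_abs_det_fderiv_smul volume hUm hder'
        hinj.injOn (fun _ => (1 : ℝ))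
      rw [himg] at h
      rw [h]
      exact (setIntegral_congr_fun hUm hpos).symm
  let v : ℕ → ℝ := fun j => ε / (j + 2)
  have hv : Function.Injective v := by
    intro i j hij
    simp only [v] at hij
    have hi : (0 : ℝ) < i + 2 := by positivity
    have hj : (0 : ℝ) < j + 2 := by positivity
    rw [div_eq_div_iff hi.ne' hj.ne'] at hij
    have := mul_left_cancel₀ hεpos.ne' hij
    have h : (i : ℝ) = j := by linarith
    exact_mod_cast h
  have hv0 : ∀ j, 0 < v j := fun j => by simp only [v]; positivity
  have hv1 : ∀ j, v j < ε := fun j => by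
    simp only [v]
    apply div_lt_self hεpos
    have : (0 : ℝ) ≤ j := by positivity
    linarith
  have hUm : MeasurableSet U := Metric.isOpen_ball.measurableSet
  have hI : ∫ x in U, (ContinuousLinearMap.id ℝ E + fderiv ℝ g x).det = 0 := by
    rw [setIntegral_congr_fun hUm hzero]; simp
  have hI2 : ∫ x in U, (ContinuousLinearMap.id ℝ E + fderiv ℝ g x).det = ∫ x in U, (1 : ℝ) := by
    simp_rw [fun x => aux_det_interp (fderiv ℝ g x) v hv]
    rw [integral_finsetSum _ (fun j _ => ((key _ (hv0 j) (hv1 j)).1.const_mul _))]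
    simp_rw [integral_const_mul]
    rw [Finset.sum_congr rfl (fun j _ => by rw [(key _ (hv0 j) (hv1 j)).2]), ← Finset.sum_mul,
      ← Polynomial.eval_finsetSum, Lagrange.sum_basis hv.injOn (by simp)]
    simp
  rw [hI] at hI2
  have hvol : 0 < volume.real U :=
    ENNReal.toReal_pos (Metric.measure_ball_pos _ _ hR).ne' measure_ball_lt_top.ne
  simp at hI2
  linarith

theorem aux_smooth {E : Type*} [NormedAddCommGroup E] [InnerProductSpace ℝ E]
    [FiniteDimensional ℝ E] [MeasurableSpace E] [BorelSpace E] (R : ℝ) (hR : 0 < R)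
    (u : E → E) (hu : ContDiff ℝ 1 u) (hne : ∀ x, ‖x‖ ≤ R → u x ≠ 0)
    (hpos : ∀ x, ‖x‖ = R → 0 < inner ℝ x (u x)) : False := by
  let d : E → ℝ := fun x => inner ℝ x (u x) ^ 2 + ‖u x‖ ^ 2 * (R ^ 2 - ‖x‖ ^ 2)
  let l : E → ℝ := fun x => (-inner ℝ x (u x) + Real.sqrt (d x)) / ‖u x‖ ^ 2
  have hdpos : ∀ x, ‖x‖ ≤ R → 0 < d x := by
    intro x hx
    have h1 : 0 < ‖u x‖ ^ 2 := by
      have := norm_pos_iff.2 (hne x hx)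
      positivity
    rcases hx.lt_or_eq with h | h
    · have h2 : 0 < R ^ 2 - ‖x‖ ^ 2 := by nlinarith [norm_nonneg x]
      have h3 := mul_pos h1 h2
      have h4 := sq_nonneg (inner ℝ x (u x))
      simp only [d]; linarith
    · have h2 := hpos x h
      simp only [d, h, sub_self, mul_zero, add_zero]
      positivity
  have hcd : ∀ x, ‖x‖ ≤ R → ContDiffAt ℝ 1 (fun x => l x • u x) x := by
    intro x hx
    have hin : ContDiff ℝ 1 fun x => inner ℝ x (u x) := contDiff_id.inner ℝ hu
    have hd : ContDiff ℝ 1 d :=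
      (hin.pow 2).add ((hu.norm_sq ℝ).mul (contDiff_const.sub (contDiff_norm_sq ℝ)))
    have h1 : ‖u x‖ ^ 2 ≠ 0 := by
      have := norm_pos_iff.2 (hne x hx)
      positivity
    exact ((hin.neg.contDiffAt.add (hd.contDiffAt.sqrt (hdpos x hx).ne')).div
      (hu.norm_sq ℝ).contDiffAt h1).smul hu.contDiffAt
  have hbd : ∀ x, ‖x‖ = R → l x = 0 := by
    intro x hx
    have h2 := hpos x hx
    simp [l, d, hx, Real.sqrt_sq h2.le]
  have hsph : ∀ x, ‖x‖ ≤ R → ‖x + l x • u x‖ = R := by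
    intro x hx
    have h1 : 0 < ‖u x‖ ^ 2 := by
      have := norm_pos_iff.2 (hne x hx)
      positivity
    have h2 := Real.sq_sqrt (hdpos x hx).le
    have h3 : l x * ‖u x‖ ^ 2 = -inner ℝ x (u x) + Real.sqrt (d x) := by
      exact div_mul_cancel₀ _ h1.ne'
    have h4 : ‖x + l x • u x‖ ^ 2 = R ^ 2 := by
      rw [norm_add_sq_real, inner_smul_right, norm_smul, mul_pow, Real.norm_eq_abs, sq_abs]
      have h5 : (l x * ‖u x‖ ^ 2 + inner ℝ x (u x)) ^ 2 = d x := by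
        rw [h3]; linear_combination h2
      have h6 : ‖u x‖ ^ 2 * (‖x‖ ^ 2 + 2 * (l x * inner ℝ x (u x)) + l x ^ 2 * ‖u x‖ ^ 2)
        = ‖u x‖ ^ 2 * R ^ 2 := by
        simp only [d] at h5
        linear_combination h5
      exact mul_left_cancel₀ h1.ne' h6
    exact (sq_eq_sq₀ (norm_nonneg _) hR.le).1 h4
  have hcdo : ContDiffOn ℝ 1 (fun x => l x • u x) (Metric.closedBall 0 R) := fun x hx =>
    (hcd x (by simpa using hx)).contDiffWithinAt
  obtain ⟨K, hK⟩ := hcdo.exists_lipschitzOnWith one_ne_zero (convex_closedBall _ _)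
    (isCompact_closedBall _ _)
  classical
  let g : E → E := fun x => if ‖x‖ ≤ R then l x • u x else 0
  have hmix : ∀ x y, ‖x‖ ≤ R → R < ‖y‖ → ‖l x • u x‖ ≤ K * ‖x - y‖ := by
    intro x y hx hy
    obtain ⟨z, hz, hzR⟩ : ∃ z ∈ segment ℝ x y, ‖z‖ = R := by
      have := (convex_segment (𝕜 := ℝ) x y).isPreconnected.intermediate_value
        (left_mem_segment ℝ x y) (right_mem_segment ℝ x y)
        (f := fun z => ‖z‖) continuous_norm.continuousOn
      exact this ⟨hx, hy.le⟩
    have h1 := hK.norm_sub_le (x := x) (y := z) (by simpa using hx) (by simp [hzR])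
    simp only [hbd z hzR, zero_smul, sub_zero] at h1
    refine h1.trans ?_
    have h2 := dist_add_dist_of_mem_segment hz
    have h3 : ‖x - z‖ ≤ ‖x - y‖ := by
      rw [← dist_eq_norm, ← dist_eq_norm]
      linarith [dist_nonneg (x := z) (y := y)]
    gcongr
  refine aux_no_retr R hR g K ?_ ?_ ?_ ?_
  · refine LipschitzWith.of_dist_le_mul fun x y => ?_
    rw [dist_eq_norm, dist_eq_norm]
    by_cases hx : ‖x‖ ≤ R <;> by_cases hy : ‖y‖ ≤ R
    · simpa [g, hx, hy] using hK.norm_sub_le (x := x) (y := y) (by simpa using hx) (by simpa using hy)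
    · simpa [g, hx, hy] using hmix x y hx (not_le.1 hy)
    · simpa [g, hx, hy, norm_sub_rev x y] using hmix y x hy (not_le.1 hx)
    · simp only [g, hx, hy, if_false, sub_self, norm_zero]
      positivity
  · intro x hx
    rcases hx.lt_or_eq with h | h
    · simp [g, not_le.2 h]
    · simp [g, h.symm, hbd x h.symm]
  · intro x hx
    refine ((hcd x hx.le).differentiableAt one_ne_zero).congr_of_eventuallyEq ?_
    filter_upwards [(isOpen_lt continuous_norm continuous_const).mem_nhds hx] with y hy
    have : ‖y‖ ≤ R := le_of_lt hy
    simp [g, this]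
  · intro x hx
    simp only [g, hx.le, if_true]
    exact hsph x hx.le

theorem aux_zero {E : Type*} [NormedAddCommGroup E] [InnerProductSpace ℝ E]
    [FiniteDimensional ℝ E] [MeasurableSpace E] [BorelSpace E] (R : ℝ) (hR : 0 < R)
    (u : E → E) (hu : Continuous u)
    (hpos : ∀ x, ‖x‖ = R → 0 < inner ℝ x (u x)) : ∃ x, u x = 0 := by
  by_contra! hne
  obtain ⟨m, hm, hm'⟩ := (isCompact_closedBall (0 : E) R).exists_forall_le'
    (f := fun x => ‖u x‖) hu.norm.continuousOn (a := 0) (fun x _ => norm_pos_iff.2 (hne x))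
  obtain ⟨c, hc, hc'⟩ := (isCompact_sphere (0 : E) R).exists_forall_le'
    (f := fun x => inner ℝ x (u x)) (continuous_id.inner hu).continuousOn (a := 0)
    (fun x hx => hpos x (by simpa using hx))
  obtain ⟨w, hw, hwd, -⟩ := hu.exists_contDiff_approx 1 (ε := fun _ => min m (c / R))
    continuous_const (fun _ => by positivity)
  refine aux_smooth R hR w (by exact_mod_cast hw) ?_ ?_
  · intro x hx h0
    have h1 := hwd x
    have h2 := hm' x (by simpa using hx)
    rw [h0, dist_zero_left] at h1
    have := h1.trans_le (min_le_left _ _)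
    linarith
  · intro x hx
    have h1 := (hwd x).trans_le (min_le_right _ _)
    have h2 := hc' x (by simpa using hx)
    rw [dist_eq_norm, lt_div_iff₀ hR] at h1
    have h3 := abs_real_inner_le_norm x (w x - u x)
    rw [inner_sub_right, hx] at h3
    have h4 := neg_abs_le (inner ℝ x (w x) - inner ℝ x (u x))
    linarith

/-- Existence of stationary solutions: if `B` is a positive diagonal matrix and `G` is
continuous and energy-preserving, then for every `F` the equation `G(x) - Bx + F = 0` has
at least one solution. -/
theorem stationary_existence (N : ℕ) [NeZero N]
    (b : ZMod N → ℝ) (hb : ∀ i, 0 < b i)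
    (G : (ZMod N → ℝ) → ZMod N → ℝ)
    (hGc : Continuous G)
    (hGe : ∀ x : ZMod N → ℝ, ∑ i : ZMod N, x i * G x i = 0)
    (F : ZMod N → ℝ) :
    ∃ x : ZMod N → ℝ, ∀ i : ZMod N, G x i - b i * x i + F i = 0 := by
  obtain ⟨i₀, hi₀⟩ := Finite.exists_min b
  let F' : EuclideanSpace ℝ (ZMod N) := WithLp.toLp 2 F
  let u : EuclideanSpace ℝ (ZMod N) → EuclideanSpace ℝ (ZMod N) := fun x =>
    WithLp.toLp 2 (fun i => b i * x i - F i - G (WithLp.ofLp x) i)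
  have hu : Continuous u := by
    refine (PiLp.continuous_toLp 2 _).comp (continuous_pi fun i => ?_)
    have h1 : Continuous fun x : EuclideanSpace ℝ (ZMod N) => G (WithLp.ofLp x) i :=
      (continuous_apply i).comp (hGc.comp (PiLp.continuous_ofLp 2 _))
    have h2 : Continuous fun x : EuclideanSpace ℝ (ZMod N) => x i :=
      (continuous_apply i).comp (PiLp.continuous_ofLp 2 _)
    exact ((continuous_const.mul h2).sub continuous_const).sub h1
  have hβ := hb i₀
  set R := ‖F'‖ / b i₀ + 1 with hRdef
  have hR : 0 < R := by positivity
  obtain ⟨x, hx⟩ := aux_zero R hR u hu (by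
    intro x hx
    have h1 : inner ℝ x (u x) = ∑ i, b i * x i ^ 2 - inner ℝ x F' := by
      have h := hGe (WithLp.ofLp x)
      simp only [PiLp.inner_apply, u, F', RCLike.inner_apply, conj_trivial]
      rw [← Finset.sum_sub_distrib, ← sub_zero (∑ i, (_ - _)), ← h, ← Finset.sum_sub_distrib]
      refine Finset.sum_congr rfl fun i _ => ?_
      ring
    have h2 : b i₀ * ‖x‖ ^ 2 ≤ ∑ i, b i * x i ^ 2 := by
      rw [EuclideanSpace.real_norm_sq_eq, Finset.mul_sum]
      exact Finset.sum_le_sum fun i _ => mul_le_mul_of_nonneg_right (hi₀ i) (sq_nonneg _)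
    have h3 := real_inner_le_norm x F'
    have h4 : b i₀ * R = ‖F'‖ + b i₀ := by rw [hRdef]; field_simp
    rw [hx] at h2 h3
    rw [h1]
    nlinarith)
  refine ⟨WithLp.ofLp x, fun i => ?_⟩
  have h := congrArg (fun y : EuclideanSpace ℝ (ZMod N) => y i) hx
  simp only [u, PiLp.zero_apply] at h
  linarith
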